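/- Let H be a Hopf algebra over ℂ and let A be a right H-comodule algebra with a ℤⁿ-grading preserved by the product and satisfying δ(A_r) ⊆ A_r⊗H, with coinvariant subalgebra B = A^{coH}, and let A_θ, B_θ be the deformations. Define χ_θ : A_θ⊗_{B_θ}A_θ → A_θ⊗H as the map induced by ã⊗a ↦ m_θ(ã, a₍₀₎) ⊗ a₍₁₎. Then χ_θ is bijective if and only if the undeformed canonical map χ : A⊗_B A → A⊗H is bijective; in particular, if B ⊆ A is an H-Hopf–Galois extension then so is B_θ ⊆ A_θ, and its translation map is the same linear map as the undeformed one. -/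

import Mathlib

/- Statement 6 (Scenario I): For a graded `H`-comodule algebra `A` (coaction preserving the
grading) with coinvariants `B`, the deformed canonical map
`χ_θ : A_θ ⊗_{B_θ} A_θ → A_θ ⊗ H`, `ã ⊗ a ↦ m_θ(ã, a₍₀₎) ⊗ a₍₁₎`, is bijective iff the
undeformed canonical map `χ` is; in particular a Hopf–Galois extension deforms to a
Hopf–Galois extension, with the same translation map (common representatives). -/

open TensorProduct DirectSum

noncomputable section

/-- The phase factor `λ_θ(r,l) = exp(πi⟨θr,l⟩)`. -/
def phase {n : ℕ} (θ : Matrix (Fin n) (Fin n) ℝ) (r l : Fin n → ℤ) : ℂ :=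
  Complex.exp ((Real.pi : ℂ) * Complex.I * ∑ j, ∑ k, (θ j k : ℂ) * (r k : ℂ) * (l j : ℂ))

/-- The deformation of the product of a graded algebra by a "bi-character" `c`. -/
def defMul {ι : Type} [DecidableEq ι] {A : Type} [Ring A] [Algebra ℂ A]
    (𝒜 : ι → Submodule ℂ A) [DirectSum.Decomposition 𝒜] (c : ι → ι → ℂ) :
    A →ₗ[ℂ] A →ₗ[ℂ] A :=
  let bil : (⨁ r, ↥(𝒜 r)) →ₗ[ℂ] (⨁ l, ↥(𝒜 l)) →ₗ[ℂ] A :=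
    DirectSum.toModule ℂ ι _ (fun r =>
      (DirectSum.toModule ℂ ι (↥(𝒜 r) →ₗ[ℂ] A) (fun l =>
        (c r l • ((LinearMap.mul ℂ A).compl₁₂ (𝒜 r).subtype (𝒜 l).subtype)).flip)).flip)
  let dec : A →ₗ[ℂ] ⨁ r, ↥(𝒜 r) := (DirectSum.decomposeLinearEquiv 𝒜).toLinearMap
  (bil ∘ₗ dec).compl₂ dec

variable {H A : Type} [Ring H] [HopfAlgebra ℂ H] [Ring A] [Algebra ℂ A]

/-- The coinvariant subspace `B = A^{co H}`. -/
def coinv (δ : A →ₐ[ℂ] A ⊗[ℂ] H) : Set A := {a | δ a = a ⊗ₜ[ℂ] (1 : H)}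

/-- The relation submodule defining `A ⊗_B A` for a bilinear product `m` on `A`. -/
def galRelOf (δ : A →ₐ[ℂ] A ⊗[ℂ] H) (m : A →ₗ[ℂ] A →ₗ[ℂ] A) : Submodule ℂ (A ⊗[ℂ] A) :=
  Submodule.span ℂ
    {x | ∃ (a a' b : A), b ∈ coinv δ ∧ x = (m a b) ⊗ₜ[ℂ] a' - a ⊗ₜ[ℂ] (m b a')}

/-- The (unbalanced) canonical Galois map for a bilinear product `m` on `A`:
`ã ⊗ a ↦ m(ã, a₍₀₎) ⊗ a₍₁₎`. -/
def chiOf (δ : A →ₐ[ℂ] A ⊗[ℂ] H) (m : A →ₗ[ℂ] A →ₗ[ℂ] A) :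
    A ⊗[ℂ] A →ₗ[ℂ] A ⊗[ℂ] H :=
  (TensorProduct.map (TensorProduct.lift m) LinearMap.id) ∘ₗ
    ((TensorProduct.assoc ℂ A A H).symm.toLinearMap) ∘ₗ
      (TensorProduct.map LinearMap.id δ.toLinearMap)

section HomogeneousScaling

variable {ι : Type} [DecidableEq ι] (𝒜 : ι → Submodule ℂ A) [DirectSum.Decomposition 𝒜]

/-- The endomorphism of a graded space acting on the component of degree `r` as the scalar `f r`. -/
def degreeScale (f : ι → ℂ) : A →ₗ[ℂ] A :=
  DirectSum.toModule ℂ ι A (fun r => f r • (𝒜 r).subtype) ∘ₗ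
    (DirectSum.decomposeLinearEquiv 𝒜).toLinearMap

lemma decomposeLinearEquiv_of_mem {r : ι} {a : A} (ha : a ∈ 𝒜 r) :
    DirectSum.decomposeLinearEquiv 𝒜 a = DirectSum.lof ℂ ι (fun i => 𝒜 i) r ⟨a, ha⟩ :=
  DirectSum.decompose_of_mem 𝒜 ha

lemma degreeScale_of_mem (f : ι → ℂ) {r : ι} {a : A} (ha : a ∈ 𝒜 r) :
    degreeScale 𝒜 f a = f r • a := by
  simp [degreeScale, decomposeLinearEquiv_of_mem 𝒜 ha]

lemma decompose_eq_degreeScale (i : ι) (a : A) :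
    (DirectSum.decompose 𝒜 a i : A) = degreeScale 𝒜 (Pi.single i 1) a := by
  induction a using DirectSum.Decomposition.inductionOn 𝒜 with
  | zero => simp
  | @homogeneous j m =>
    rw [degreeScale_of_mem 𝒜 _ m.2]
    by_cases h : j = i
    · subst h; simp
    · rw [DirectSum.decompose_of_mem_ne 𝒜 m.2 h, Pi.single_eq_of_ne h, zero_smul]
  | add x y hx hy => simp [DirectSum.decompose_add, hx, hy]

/-- The endomorphism of `A ⊗ A` acting on `A_r ⊗ A_l` as the scalar `c r l`. -/
def bidegreeScale (c : ι → ι → ℂ) : A ⊗[ℂ] A →ₗ[ℂ] A ⊗[ℂ] A :=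
  TensorProduct.lift
    (DirectSum.toModule ℂ ι (A →ₗ[ℂ] A ⊗[ℂ] A)
      (fun r => (TensorProduct.mk ℂ A A).compl₁₂ (𝒜 r).subtype (degreeScale 𝒜 (c r))) ∘ₗ
        (DirectSum.decomposeLinearEquiv 𝒜).toLinearMap)

lemma bidegreeScale_tmul (c : ι → ι → ℂ) {r l : ι} {a a' : A} (ha : a ∈ 𝒜 r) (ha' : a' ∈ 𝒜 l) :
    bidegreeScale 𝒜 c (a ⊗ₜ a') = c r l • (a ⊗ₜ a') := by
  simp [bidegreeScale, decomposeLinearEquiv_of_mem 𝒜 ha, degreeScale_of_mem 𝒜 _ ha']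

lemma defMul_of_mem (c : ι → ι → ℂ) {r l : ι} {a a' : A} (ha : a ∈ 𝒜 r) (ha' : a' ∈ 𝒜 l) :
    defMul 𝒜 c a a' = c r l • (a * a') := by
  simp [defMul, decomposeLinearEquiv_of_mem 𝒜 ha, decomposeLinearEquiv_of_mem 𝒜 ha']

variable {M : Type} [AddCommGroup M] [Module ℂ M]

lemma linearMap_ext_of_homogeneous {f g : A →ₗ[ℂ] M} (h : ∀ r, ∀ a ∈ 𝒜 r, f a = g a) : f = g := by
  ext a
  induction a using DirectSum.Decomposition.inductionOn 𝒜 with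
  | zero => simp
  | @homogeneous j m => exact h j m m.2
  | add x y hx hy => simp [hx, hy]

lemma tensor_ext_of_homogeneous {f g : A ⊗[ℂ] A →ₗ[ℂ] M}
    (h : ∀ r l, ∀ a ∈ 𝒜 r, ∀ a' ∈ 𝒜 l, f (a ⊗ₜ a') = g (a ⊗ₜ a')) : f = g := by
  apply TensorProduct.ext
  refine linearMap_ext_of_homogeneous 𝒜 fun r a ha => ?_
  exact linearMap_ext_of_homogeneous 𝒜 fun l a' ha' => h r l a ha a' ha'

lemma defMul_one : defMul 𝒜 1 = LinearMap.mul ℂ A := by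
  refine linearMap_ext_of_homogeneous 𝒜 fun r a ha => ?_
  refine linearMap_ext_of_homogeneous 𝒜 fun l a' ha' => ?_
  simp [defMul_of_mem 𝒜 _ ha ha']

lemma bidegreeScale_one : bidegreeScale 𝒜 1 = LinearMap.id :=
  tensor_ext_of_homogeneous 𝒜 fun r l a ha a' ha' => by simp [bidegreeScale_tmul 𝒜 _ ha ha']

lemma bidegreeScale_comp (c d : ι → ι → ℂ) :
    bidegreeScale 𝒜 c ∘ₗ bidegreeScale 𝒜 d = bidegreeScale 𝒜 (c * d) :=
  tensor_ext_of_homogeneous 𝒜 fun r l a ha a' ha' => by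
    simp [bidegreeScale_tmul 𝒜 _ ha ha', smul_smul, mul_comm]

/-- The coaction maps each homogeneous component `A_r` into `A_r ⊗ H`. -/
def PreservesGrading (δ : A →ₐ[ℂ] A ⊗[ℂ] H) : Prop :=
  ∀ (r : ι) (a : A), a ∈ 𝒜 r →
    δ a ∈ LinearMap.range (TensorProduct.map (𝒜 r).subtype (LinearMap.id (M := H)))

variable {𝒜} {δ : A →ₐ[ℂ] A ⊗[ℂ] H}

lemma PreservesGrading.coaction_degreeScale (hδ : PreservesGrading 𝒜 δ) (f : ι → ℂ) (a : A) :
    δ (degreeScale 𝒜 f a) = TensorProduct.map (degreeScale 𝒜 f) LinearMap.id (δ a) := by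
  suffices h : δ.toLinearMap ∘ₗ degreeScale 𝒜 f =
      TensorProduct.map (degreeScale 𝒜 f) LinearMap.id ∘ₗ δ.toLinearMap from
    LinearMap.congr_fun h a
  refine linearMap_ext_of_homogeneous 𝒜 fun r a ha => ?_
  obtain ⟨y, hy⟩ := hδ r a ha
  simp only [LinearMap.comp_apply, degreeScale_of_mem 𝒜 f ha, map_smul, AlgHom.toLinearMap_apply,
    ← hy]
  clear hy
  induction y with
  | zero => simp
  | tmul x h => simp [degreeScale_of_mem 𝒜 f x.2, TensorProduct.smul_tmul']
  | add x y hx hy => simp_all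

lemma PreservesGrading.decompose_mem_coinv (hδ : PreservesGrading 𝒜 δ) {b : A}
    (hb : b ∈ coinv δ) (i : ι) : (DirectSum.decompose 𝒜 b i : A) ∈ coinv δ := by
  have hb' : δ b = b ⊗ₜ 1 := hb
  simp [coinv, decompose_eq_degreeScale, hδ.coaction_degreeScale, hb']

lemma chiOf_tmul (m : A →ₗ[ℂ] A →ₗ[ℂ] A) (a a' : A) :
    chiOf δ m (a ⊗ₜ a') = TensorProduct.map (m a) LinearMap.id (δ a') := by
  simp only [chiOf, LinearMap.comp_apply, TensorProduct.map_tmul, LinearMap.id_apply,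
    AlgHom.toLinearMap_apply, LinearEquiv.coe_coe]
  induction δ a' with
  | zero => simp
  | tmul x h => simp
  | add x y hx hy => simp_all [TensorProduct.tmul_add]

lemma PreservesGrading.chiOf_bidegreeScale (hδ : PreservesGrading 𝒜 δ) (c : ι → ι → ℂ) :
    chiOf δ (LinearMap.mul ℂ A) ∘ₗ bidegreeScale 𝒜 c = chiOf δ (defMul 𝒜 c) := by
  refine tensor_ext_of_homogeneous 𝒜 fun r l a ha a' ha' => ?_
  obtain ⟨y, hy⟩ := hδ l a' ha'
  simp only [LinearMap.comp_apply, bidegreeScale_tmul 𝒜 c ha ha', map_smul, chiOf_tmul, ← hy]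
  clear hy
  induction y with
  | zero => simp
  | tmul x h => simp [defMul_of_mem 𝒜 c ha x.2, TensorProduct.smul_tmul']
  | add x y hx hy => simp_all

end HomogeneousScaling

section GradedAlgebra

variable {ι : Type} [DecidableEq ι] [AddMonoid ι] {𝒜 : ι → Submodule ℂ A} [GradedAlgebra 𝒜]
  {δ : A →ₐ[ℂ] A ⊗[ℂ] H}

lemma PreservesGrading.map_degreeScale_chiOf (hδ : PreservesGrading 𝒜 δ) (f : ι → ℂ)
    (t : A ⊗[ℂ] A) :
    TensorProduct.map (degreeScale 𝒜 f) LinearMap.id (chiOf δ (LinearMap.mul ℂ A) t) =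
      chiOf δ (LinearMap.mul ℂ A) (bidegreeScale 𝒜 (fun r l => f (r + l)) t) := by
  suffices h : TensorProduct.map (degreeScale 𝒜 f) LinearMap.id ∘ₗ chiOf δ (LinearMap.mul ℂ A) =
      chiOf δ (LinearMap.mul ℂ A) ∘ₗ bidegreeScale 𝒜 (fun r l => f (r + l)) from
    LinearMap.congr_fun h t
  refine tensor_ext_of_homogeneous 𝒜 fun r l a ha a' ha' => ?_
  obtain ⟨y, hy⟩ := hδ l a' ha'
  simp only [LinearMap.comp_apply, bidegreeScale_tmul 𝒜 _ ha ha', map_smul, chiOf_tmul, ← hy]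
  clear hy
  induction y with
  | zero => simp
  | tmul x h =>
    simp [degreeScale_of_mem 𝒜 f (SetLike.mul_mem_graded ha x.2), TensorProduct.smul_tmul']
  | add x y hx hy => simp_all

/-- Scaling by a bicharacter `d` carries the balancing relations of the product deformed by `c * d`
into those of the product deformed by `c`. -/
lemma PreservesGrading.galRelOf_mul_le_comap (hδ : PreservesGrading 𝒜 δ) (c d : ι → ι → ℂ)
    (hd_left : ∀ r s l, d (r + s) l = d r l * d s l)
    (hd_right : ∀ r s l, d r (s + l) = d r s * d r l) :
    galRelOf δ (defMul 𝒜 (c * d)) ≤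
      (galRelOf δ (defMul 𝒜 c)).comap (bidegreeScale 𝒜 d) := by
  rw [galRelOf, Submodule.span_le]
  rintro _ ⟨a, a', b, hb, rfl⟩
  change bidegreeScale 𝒜 d _ ∈ galRelOf δ (defMul 𝒜 c)
  induction a using DirectSum.Decomposition.inductionOn 𝒜 with
  | zero => simp
  | add x y hx hy =>
    convert add_mem hx hy using 1
    simp only [map_add, LinearMap.add_apply, TensorProduct.add_tmul, map_sub]
    abel
  | @homogeneous r a =>
  induction a' using DirectSum.Decomposition.inductionOn 𝒜 with
  | zero => simp
  | add x y hx hy =>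
    convert add_mem hx hy using 1
    simp only [map_add, TensorProduct.tmul_add, map_sub]
    abel
  | @homogeneous l a' =>
  classical
  rw [← DirectSum.sum_support_decompose 𝒜 b]
  simp only [map_sum, LinearMap.sum_apply, TensorProduct.sum_tmul, TensorProduct.tmul_sum,
    ← Finset.sum_sub_distrib]
  refine sum_mem fun s _ => ?_
  have hs := hδ.decompose_mem_coinv hb s
  generalize DirectSum.decompose 𝒜 b s = b at hs ⊢
  rw [map_sub, defMul_of_mem 𝒜 _ a.2 b.2, defMul_of_mem 𝒜 _ b.2 a'.2,
    ← TensorProduct.smul_tmul', TensorProduct.tmul_smul, map_smul, map_smul,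
    bidegreeScale_tmul 𝒜 d (SetLike.mul_mem_graded a.2 b.2) a'.2,
    bidegreeScale_tmul 𝒜 d a.2 (SetLike.mul_mem_graded b.2 a'.2)]
  have key := (galRelOf δ (defMul 𝒜 c)).smul_mem (d r s * d r l * d s l)
    (Submodule.subset_span ⟨a, a', b, hs, rfl⟩)
  rw [defMul_of_mem 𝒜 _ a.2 b.2, defMul_of_mem 𝒜 _ b.2 a'.2,
    ← TensorProduct.smul_tmul', TensorProduct.tmul_smul] at key
  convert key using 1
  simp only [smul_sub, smul_smul, hd_left, hd_right, Pi.mul_apply]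
  congr 2 <;> ring

end GradedAlgebra

section LiftQ

variable {V W : Type} [AddCommGroup V] [Module ℂ V] [AddCommGroup W] [Module ℂ W]

lemma liftQ_bijective_iff (p : Submodule ℂ V) (f : V →ₗ[ℂ] W) (hp : p ≤ LinearMap.ker f) :
    Function.Bijective (p.liftQ f hp) ↔ LinearMap.ker f ≤ p ∧ Function.Surjective f := by
  refine and_congr ?_ ?_
  · rw [← LinearMap.ker_eq_bot, Submodule.ker_liftQ, ← le_bot_iff, Submodule.map_le_iff_le_comap,
      Submodule.comap_bot, Submodule.ker_mkQ]
  · rw [← LinearMap.range_eq_top, Submodule.range_liftQ, LinearMap.range_eq_top]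

/-- An isomorphism matching two submodules and two maps matches bijectivity of the quotient maps. -/
lemma liftQ_bijective_iff_of_equiv {p q : Submodule ℂ V} {f g : V →ₗ[ℂ] W}
    (hp : p ≤ LinearMap.ker f) (hq : q ≤ LinearMap.ker g) (e : V ≃ₗ[ℂ] V)
    (hfg : f ∘ₗ e.toLinearMap = g) (hqp : q ≤ p.comap e.toLinearMap)
    (hpq : p ≤ q.comap e.symm.toLinearMap) :
    Function.Bijective (q.liftQ g hq) ↔ Function.Bijective (p.liftQ f hp) := by
  subst hfg
  rw [liftQ_bijective_iff, liftQ_bijective_iff]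
  refine and_congr ⟨fun h x hx => ?_, fun h x hx => ?_⟩ ?_
  · simpa using hqp (h (show e.symm x ∈ _ by simpa using hx))
  · simpa using hpq (h (show e x ∈ _ by simpa using hx))
  · exact e.surjective.of_comp_iff f

end LiftQ

section Phase

variable {n : ℕ} (θ : Matrix (Fin n) (Fin n) ℝ)

lemma phase_add_left (r s l : Fin n → ℤ) : phase θ (r + s) l = phase θ r l * phase θ s l := by
  simp only [phase, ← Complex.exp_add]
  simp only [Pi.add_apply, Int.cast_add, mul_add, add_mul, Finset.sum_add_distrib]

lemma phase_add_right (r s l : Fin n → ℤ) : phase θ r (s + l) = phase θ r s * phase θ r l := by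
  simp only [phase, ← Complex.exp_add]
  simp only [Pi.add_apply, Int.cast_add, mul_add, Finset.sum_add_distrib]

lemma phase_ne_zero (r l : Fin n → ℤ) : phase θ r l ≠ 0 := Complex.exp_ne_zero _

lemma phase_mul_inv : phase θ * (phase θ)⁻¹ = 1 := by
  ext r l
  exact mul_inv_cancel₀ (phase_ne_zero θ r l)

variable {θ}

lemma phase_of_add_eq_zero (hθ : ∀ j k, θ k j = - θ j k) {r l : Fin n → ℤ} (h : r + l = 0) :
    phase θ r l = 1 := by
  obtain rfl : l = -r := (neg_eq_of_add_eq_zero_right h).symm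
  have hsum : ∑ j, ∑ k, (θ j k : ℂ) * (r k : ℂ) * ((-r) j : ℤ) = 0 := by
    rw [← self_eq_neg, ← Finset.sum_neg_distrib]
    conv_lhs => rw [Finset.sum_comm]
    refine Finset.sum_congr rfl fun j _ => ?_
    rw [← Finset.sum_neg_distrib]
    refine Finset.sum_congr rfl fun k _ => ?_
    rw [hθ j k]
    simp only [Pi.neg_apply]
    push_cast
    ring
  rw [phase, hsum, mul_zero, Complex.exp_zero]

end Phase

theorem deformed_canonical_map_bijective_iff {n : ℕ} (θ : Matrix (Fin n) (Fin n) ℝ)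
    (hθ : ∀ j k, θ k j = - θ j k)
    (𝒜 : (Fin n → ℤ) → Submodule ℂ A) [GradedAlgebra 𝒜]
    (δ : A →ₐ[ℂ] A ⊗[ℂ] H)
    (hcoassoc : ∀ a : A,
      (TensorProduct.map LinearMap.id (Coalgebra.comul (R := ℂ) (A := H))) (δ a)
        = (TensorProduct.assoc ℂ A H H) ((TensorProduct.map δ.toLinearMap LinearMap.id) (δ a)))
    (hcounit : ∀ a : A,
      (TensorProduct.rid ℂ A)
        ((TensorProduct.map LinearMap.id (Coalgebra.counit (R := ℂ) (A := H))) (δ a)) = a)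
    -- the coaction preserves the grading: `δ(A_r) ⊆ A_r ⊗ H`
    (hgrad : ∀ (r : Fin n → ℤ) (a : A), a ∈ 𝒜 r →
      δ a ∈ LinearMap.range (TensorProduct.map (𝒜 r).subtype (LinearMap.id (M := H))))
    -- both canonical maps descend to the balanced tensor products
    (hker : galRelOf δ (LinearMap.mul ℂ A) ≤ LinearMap.ker (chiOf δ (LinearMap.mul ℂ A)))
    (hkerθ : galRelOf δ (defMul 𝒜 (phase θ)) ≤ LinearMap.ker (chiOf δ (defMul 𝒜 (phase θ)))) :
    -- `χ_θ` is bijective iff `χ` is bijective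
    (Function.Bijective
        ((galRelOf δ (defMul 𝒜 (phase θ))).liftQ (chiOf δ (defMul 𝒜 (phase θ))) hkerθ) ↔
      Function.Bijective
        ((galRelOf δ (LinearMap.mul ℂ A)).liftQ (chiOf δ (LinearMap.mul ℂ A)) hker)) ∧
    -- when Hopf--Galois, both canonical maps admit common translation-map representatives
    (Function.Bijective
        ((galRelOf δ (LinearMap.mul ℂ A)).liftQ (chiOf δ (LinearMap.mul ℂ A)) hker) →
      ∀ h : H, ∃ t : A ⊗[ℂ] A,
        chiOf δ (LinearMap.mul ℂ A) t = (1 : A) ⊗ₜ[ℂ] h ∧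
        chiOf δ (defMul 𝒜 (phase θ)) t = (1 : A) ⊗ₜ[ℂ] h) := by
  have hδ : PreservesGrading 𝒜 δ := hgrad
  have hχ := hδ.chiOf_bidegreeScale (phase θ)
  constructor
  · let e : A ⊗[ℂ] A ≃ₗ[ℂ] A ⊗[ℂ] A := LinearEquiv.ofLinearMap
      (bidegreeScale 𝒜 (phase θ)) (bidegreeScale 𝒜 (phase θ)⁻¹)
      (by rw [bidegreeScale_comp, phase_mul_inv, bidegreeScale_one])
      (by rw [bidegreeScale_comp, mul_comm, phase_mul_inv, bidegreeScale_one])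
    refine liftQ_bijective_iff_of_equiv hker hkerθ e hχ ?_ ?_
    · change _ ≤ Submodule.comap (bidegreeScale 𝒜 (phase θ)) _
      simpa only [one_mul, defMul_one] using hδ.galRelOf_mul_le_comap 1 (phase θ)
        (phase_add_left θ) (phase_add_right θ)
    · change _ ≤ Submodule.comap (bidegreeScale 𝒜 (phase θ)⁻¹) _
      simpa only [phase_mul_inv, defMul_one] using
        hδ.galRelOf_mul_le_comap (phase θ) (phase θ)⁻¹
          (fun r s l => by simp [phase_add_left, mul_comm])
          (fun r s l => by simp [phase_add_right, mul_comm])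
  · intro hbij h
    obtain ⟨t, ht⟩ := ((liftQ_bijective_iff _ _ hker).1 hbij).2 (1 ⊗ₜ h)
    let f : (Fin n → ℤ) → ℂ := Pi.single 0 1
    have ht₀ : chiOf δ (LinearMap.mul ℂ A) (bidegreeScale 𝒜 (fun r l => f (r + l)) t) =
        1 ⊗ₜ h := by
      rw [← hδ.map_degreeScale_chiOf f, ht, TensorProduct.map_tmul,
        degreeScale_of_mem 𝒜 f SetLike.GradedOne.one_mem]
      simp [f]
    refine ⟨bidegreeScale 𝒜 (fun r l => f (r + l)) t, ht₀, ?_⟩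
    have hphase : (phase θ * fun r l => f (r + l)) = fun r l => f (r + l) := by
      ext r l
      by_cases hrl : r + l = 0
      · simp [phase_of_add_eq_zero hθ hrl]
      · simp [f, hrl]
    rw [← hχ, LinearMap.comp_apply, ← LinearMap.comp_apply (bidegreeScale 𝒜 (phase θ)),
      bidegreeScale_comp, hphase, ht₀]

end
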